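/- arXiv:1703.08998 — 2 statements merged into one kernel-verified Lean document; each statement's English description precedes it below -/
import Mathlib

section
/- For N sufficiently large, and for any real numbers a_1, …, a_m with m = ⌊N/(100 log₂ N)⌋, the intersection ⋂_{i=1}^m (X + a_i) (computed modulo 1, i.e., in ℝ/ℤ) is nonempty, where X is the middle 1/N-th Cantor set. -/
open Set

/-- ratio (N-1)/(2N) of each half of the middle-1/N Cantor construction -/
noncomputable def cantorRatio (N : ℕ) : ℝ := (N - 1) / (2 * N)

/-- k-th stage C_k of the middle 1/N Cantor set -/
noncomputable def cantorStage (N : ℕ) : ℕ → Set ℝ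
  | 0 => Set.Icc 0 1
  | k + 1 => (fun x => cantorRatio N * x) '' cantorStage N k ∪
      (fun x => cantorRatio N * x + (N + 1) / (2 * N)) '' cantorStage N k

/-- the middle 1/N Cantor set -/
noncomputable def middleCantorSet (N : ℕ) : Set ℝ := ⋂ k, cantorStage N k

/-- number of stages whose removed middle intervals have length at least δ -/
noncomputable def numStages (N : ℕ) (δ : ℝ) : ℕ :=
  sSup {j : ℕ | δ ≤ 1 / N * cantorRatio N ^ (j - 1)}

/-- X_δ : perform only the removal steps removing intervals of length ≥ δ -/
noncomputable def cantorApprox (N : ℕ) (δ : ℝ) : Set ℝ := cantorStage N (numStages N δ)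

/-- translate of a set of reals by b, taken modulo 1 -/
noncomputable def transl (b : ℝ) (S : Set ℝ) : Set (AddCircle (1 : ℝ)) :=
  (fun x : ℝ => (x : AddCircle (1 : ℝ)) + (b : AddCircle (1 : ℝ))) '' S

/-- the nodes of depth `l` of the binary tree (node `n` has parent `n / 2`) that remain once the
bad nodes of depth at least `1` and all their descendants are deleted -/
noncomputable def survivors (bad : ℕ → ℕ → Prop) : ℕ → Finset ℕ
  | 0 => {0}
  | l + 1 => by
      classical
      exact (Finset.range (2 ^ (l + 1))).filter (fun n => n / 2 ∈ survivors bad l ∧ ¬ bad (l + 1) n)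

lemma mem_survivors_succ {bad : ℕ → ℕ → Prop} {l n : ℕ} :
    n ∈ survivors bad (l + 1) ↔
      n < 2 ^ (l + 1) ∧ n / 2 ∈ survivors bad l ∧ ¬ bad (l + 1) n := by
  simp [survivors]

lemma lt_of_mem_survivors {bad : ℕ → ℕ → Prop} {l n : ℕ} (h : n ∈ survivors bad l) :
    n < 2 ^ l := by
  cases l with
  | zero => simp_all [survivors]
  | succ l => exact (mem_survivors_succ.1 h).1

lemma div_mem_survivors {bad : ℕ → ℕ → Prop} (k : ℕ) : ∀ {l n : ℕ},
    n ∈ survivors bad (l + k) → n / 2 ^ k ∈ survivors bad l := by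
  induction k with
  | zero => intro l n h; simpa using h
  | succ k ih =>
    intro l n h
    have h2 := ih (mem_survivors_succ.1 (show n ∈ survivors bad ((l + k) + 1) from h)).2.1
    rwa [Nat.div_div_eq_div_mul, ← pow_succ'] at h2

open Classical in
/-- If every node of depth `k` has at most `D` bad descendants of depth `k + j + 1`, then passing
from depth `k + j` to depth `k + j + 1` doubles the number of survivors up to an explicit loss. -/
lemma two_mul_card_survivors_le {bad : ℕ → ℕ → Prop} {k j D : ℕ}
    (hD : ∀ p, ((Finset.Ico (p * 2 ^ (j + 1)) ((p + 1) * 2 ^ (j + 1))).filter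
      (bad (k + j + 1))).card ≤ D) :
    2 * (survivors bad (k + j)).card ≤
      (survivors bad (k + j + 1)).card + D * (survivors bad k).card := by
  set children := (survivors bad (k + j)).biUnion (fun n => ({2 * n, 2 * n + 1} : Finset ℕ))
    with hch
  have hc : children.card = 2 * (survivors bad (k + j)).card := by
    rw [hch, Finset.card_biUnion]
    · rw [Finset.sum_congr rfl (fun n _ => Finset.card_pair (by omega : 2 * n ≠ 2 * n + 1))]
      simp [mul_comm]
    · intro a _ b _ hab
      simp only [Finset.disjoint_left, Finset.mem_insert, Finset.mem_singleton]
      omega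
  have hsub : children ⊆ survivors bad (k + j + 1) ∪ (survivors bad k).biUnion
      (fun p => (Finset.Ico (p * 2 ^ (j + 1)) ((p + 1) * 2 ^ (j + 1))).filter
        (bad (k + j + 1))) := by
    intro n hn
    simp only [hch, Finset.mem_biUnion, Finset.mem_insert, Finset.mem_singleton] at hn
    obtain ⟨p, hp, hn⟩ := hn
    have hlt := lt_of_mem_survivors hp
    have hp2 : n / 2 = p := by omega
    have hn2 : n < 2 ^ (k + j + 1) := by rw [pow_succ]; omega
    by_cases hb : bad (k + j + 1) n
    · refine Finset.mem_union_right _ (Finset.mem_biUnion.2 ⟨n / 2 ^ (j + 1), ?_, ?_⟩)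
      · have := div_mem_survivors j hp
        rwa [← hp2, Nat.div_div_eq_div_mul, ← pow_succ'] at this
      · rw [Finset.mem_filter, Finset.mem_Ico]
        exact ⟨⟨Nat.div_mul_le_self _ _, by
          rw [mul_comm]; exact Nat.lt_mul_div_succ n (by positivity)⟩, hb⟩
    · exact Finset.mem_union_left _ (mem_survivors_succ.2 ⟨hn2, hp2 ▸ hp, hb⟩)
  calc 2 * (survivors bad (k + j)).card = children.card := hc.symm
    _ ≤ _ := Finset.card_le_card hsub
    _ ≤ _ := Finset.card_union_le _ _
    _ ≤ _ := by
      gcongr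
      rw [mul_comm]
      exact Finset.card_biUnion_le_card_mul _ _ _ (fun p _ => hD p)

lemma two_mul_card_survivors_le_of_not_bad {bad : ℕ → ℕ → Prop} {l : ℕ}
    (h : ∀ n, ¬ bad (l + 1) n) :
    2 * (survivors bad l).card ≤ (survivors bad (l + 1)).card := by
  classical
  simpa using two_mul_card_survivors_le (bad := bad) (k := l) (j := 0) (D := 0)
    (fun p => by simp [h])

lemma two_pow_le_two_mul_pow (j : ℕ) :
    (2 : ℝ) ^ j ≤ 2 * (2 - 1 / ((j : ℝ) + 1)) ^ j := by
  have hj : (0 : ℝ) < (j : ℝ) + 1 := by positivity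
  have h1 : 1 / ((j : ℝ) + 1) ≤ 1 := by rw [div_le_one hj]; linarith [Nat.cast_nonneg (α := ℝ) j]
  have hb := one_add_mul_le_pow (a := -(1 / (2 * ((j : ℝ) + 1)))) (by
    rw [show 1 / (2 * ((j : ℝ) + 1)) = 1 / ((j : ℝ) + 1) / 2 by field_simp]; linarith) j
  have h2 : (1 : ℝ) / 2 ≤ 1 + j * -(1 / (2 * ((j : ℝ) + 1))) := by
    have : (j : ℝ) * (1 / (2 * ((j : ℝ) + 1))) ≤ 1 / 2 := by
      rw [mul_one_div, div_le_div_iff₀ (by positivity) (by norm_num)]; linarith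
    linarith
  have h3 : (2 - 1 / ((j : ℝ) + 1)) ^ j = 2 ^ j * (1 + -(1 / (2 * ((j : ℝ) + 1)))) ^ j := by
    rw [← mul_pow]; congr 1; field_simp; ring
  rw [h3]
  have h4 := mul_le_mul_of_nonneg_left (h2.trans hb) (by positivity : (0 : ℝ) ≤ 2 ^ j)
  linarith

open Classical in
/-- If bad nodes are sparse among the descendants `j + 1` generations away, then the number of
survivors grows by a factor at least `2 - 1 / (j + 1)` with each generation. -/
lemma mul_card_survivors_le {bad : ℕ → ℕ → Prop} {j D : ℕ}
    (h0 : ∀ l ≤ j, ∀ n, ¬ bad l n)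
    (hD : ∀ l p, ((Finset.Ico (p * 2 ^ (j + 1)) ((p + 1) * 2 ^ (j + 1))).filter
      (bad l)).card ≤ D)
    (hjD : 4 * (j + 1) * D ≤ 2 ^ (j + 1)) (l : ℕ) :
    (2 - 1 / ((j : ℝ) + 1)) * (survivors bad l).card ≤ (survivors bad (l + 1)).card := by
  have hj : (0 : ℝ) < (j : ℝ) + 1 := by positivity
  set q : ℝ := 2 - 1 / ((j : ℝ) + 1) with hq
  have hq0 : 0 ≤ q := by
    have : 1 / ((j : ℝ) + 1) ≤ 1 := by
      rw [div_le_one hj]; linarith [Nat.cast_nonneg (α := ℝ) j]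
    linarith
  induction l using Nat.strong_induction_on with
  | _ l ih =>
    rcases lt_or_ge l j with hl | hl
    · have h := two_mul_card_survivors_le_of_not_bad (h0 (l + 1) hl)
      have h' : (2 : ℝ) * (survivors bad l).card ≤ (survivors bad (l + 1)).card := by
        exact_mod_cast h
      have : 0 ≤ 1 / ((j : ℝ) + 1) * (survivors bad l).card := by positivity
      rw [hq]; linarith
    · obtain ⟨k, rfl⟩ := Nat.exists_eq_add_of_le' hl
      have hgrow : ∀ t ≤ j, q ^ t * (survivors bad k).card ≤ (survivors bad (k + t)).card := by
        intro t
        induction t with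
        | zero => simp
        | succ t iht =>
          intro ht
          calc q ^ (t + 1) * (survivors bad k).card
              = q * (q ^ t * (survivors bad k).card) := by ring
            _ ≤ q * (survivors bad (k + t)).card := by gcongr; exact iht (by omega)
            _ ≤ _ := ih (k + t) (by omega)
      have h : (2 : ℝ) * (survivors bad (k + j)).card ≤
          (survivors bad (k + j + 1)).card + D * (survivors bad k).card := by
        exact_mod_cast two_mul_card_survivors_le (hD (k + j + 1))
      have hDq : ((j : ℝ) + 1) * D ≤ q ^ j := by
        have h1 : (4 : ℝ) * (j + 1) * D ≤ 2 ^ (j + 1) := by exact_mod_cast hjD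
        have h2 := two_pow_le_two_mul_pow j
        rw [pow_succ] at h1
        linarith
      have hloss : (D : ℝ) * (survivors bad k).card ≤
          1 / ((j : ℝ) + 1) * (survivors bad (k + j)).card := by
        rw [one_div_mul_eq_div, le_div_iff₀ hj]
        calc (D : ℝ) * (survivors bad k).card * (j + 1)
            = ((j + 1) * D) * (survivors bad k).card := by ring
          _ ≤ q ^ j * (survivors bad k).card := by gcongr
          _ ≤ _ := hgrow j le_rfl
      rw [hq]; linarith

open Classical in
lemma survivors_nonempty {bad : ℕ → ℕ → Prop} {j D : ℕ}
    (h0 : ∀ l ≤ j, ∀ n, ¬ bad l n)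
    (hD : ∀ l p, ((Finset.Ico (p * 2 ^ (j + 1)) ((p + 1) * 2 ^ (j + 1))).filter
      (bad l)).card ≤ D)
    (hjD : 4 * (j + 1) * D ≤ 2 ^ (j + 1)) (l : ℕ) : (survivors bad l).Nonempty := by
  induction l with
  | zero => simp [survivors]
  | succ l ih =>
    have h := mul_card_survivors_le h0 hD hjD l
    have hq : (1 : ℝ) ≤ 2 - 1 / ((j : ℝ) + 1) := by
      have : 1 / ((j : ℝ) + 1) ≤ 1 := by
        rw [div_le_one (by positivity)]; linarith [Nat.cast_nonneg (α := ℝ) j]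
      linarith
    have hc : (0 : ℝ) < (survivors bad l).card := by exact_mod_cast ih.card_pos
    have : (0 : ℝ) < (survivors bad (l + 1)).card := by nlinarith
    exact Finset.card_pos.1 (by exact_mod_cast this)

/-- the closed dyadic interval with index `n` at depth `l` -/
def dyadicIcc (l n : ℕ) : Set ℝ := Set.Icc ((n : ℝ) / 2 ^ l) (((n : ℝ) + 1) / 2 ^ l)

lemma dyadicIcc_succ_subset (l n : ℕ) : dyadicIcc (l + 1) n ⊆ dyadicIcc l (n / 2) := by
  have h1 : ((n / 2 : ℕ) : ℝ) * 2 ≤ n := by exact_mod_cast Nat.div_mul_le_self n 2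
  have h2 : (n : ℝ) + 1 ≤ (((n / 2 : ℕ) : ℝ) + 1) * 2 := by
    exact_mod_cast (by omega : n + 1 ≤ (n / 2 + 1) * 2)
  apply Set.Icc_subset_Icc
  · rw [pow_succ, div_le_div_iff₀ (by positivity) (by positivity)]
    nlinarith [pow_pos (two_pos : (0 : ℝ) < 2) l]
  · rw [pow_succ, div_le_div_iff₀ (by positivity) (by positivity)]
    nlinarith [pow_pos (two_pos : (0 : ℝ) < 2) l]

/-- By compactness, there is a real number lying in a surviving dyadic interval at every depth. -/
lemma exists_mem_dyadicIcc_survivors {bad : ℕ → ℕ → Prop}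
    (h : ∀ l, (survivors bad l).Nonempty) :
    ∃ y : ℝ, ∀ l, ∃ n ∈ survivors bad l, y ∈ dyadicIcc l n := by
  have hcomp : ∀ l, IsCompact (⋃ n ∈ survivors bad l, dyadicIcc l n) := fun l =>
    (survivors bad l).isCompact_biUnion (fun n _ => isCompact_Icc)
  have hanti : ∀ l, (⋃ n ∈ survivors bad (l + 1), dyadicIcc (l + 1) n) ⊆
      ⋃ n ∈ survivors bad l, dyadicIcc l n := fun l =>
    Set.iUnion₂_subset fun n hn => (dyadicIcc_succ_subset l n).trans
      (Set.subset_iUnion₂_of_subset _ (mem_survivors_succ.1 hn).2.1 subset_rfl)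
  have hne : ∀ l, (⋃ n ∈ survivors bad l, dyadicIcc l n).Nonempty := by
    intro l
    obtain ⟨n, hn⟩ := h l
    refine ⟨(n : ℝ) / 2 ^ l, Set.mem_iUnion₂.2 ⟨n, hn, le_rfl, ?_⟩⟩
    gcongr
    linarith
  obtain ⟨y, hy⟩ := IsCompact.nonempty_iInter_of_sequence_nonempty_isCompact_isClosed
    (fun l => ⋃ n ∈ survivors bad l, dyadicIcc l n) hanti hne (hcomp 0)
    (fun l => (hcomp l).isClosed)
  refine ⟨y, fun l => ?_⟩
  simpa using Set.mem_iInter.1 hy l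

/-- the union of the open intervals removed at step `s` -/
noncomputable def cantorGap (N s : ℕ) : Set ℝ := cantorStage N s \ cantorStage N (s + 1)

lemma mem_cantorStage_of_notMem_cantorGap {N : ℕ} {x : ℝ} (hx : x ∈ Set.Icc (0 : ℝ) 1)
    (h : ∀ s, x ∉ cantorGap N s) (k : ℕ) : x ∈ cantorStage N k := by
  induction k with
  | zero => exact hx
  | succ k ih => by_contra hk; exact h k ⟨ih, hk⟩

lemma two_mul_cantorRatio {N : ℕ} (hN : 1 ≤ N) : 2 * cantorRatio N = 1 - 1 / N := by
  have : (N : ℝ) ≠ 0 := by positivity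
  rw [cantorRatio]; field_simp

lemma cantorRatio_pos {N : ℕ} (hN : 2 ≤ N) : 0 < cantorRatio N := by
  have : (2 : ℝ) ≤ N := by exact_mod_cast hN
  rw [cantorRatio]
  exact div_pos (by linarith) (by linarith)

lemma cantorRatio_lt_half {N : ℕ} (hN : 1 ≤ N) : cantorRatio N < 1 / 2 := by
  have h := two_mul_cantorRatio hN
  have : (0 : ℝ) < 1 / N := by positivity
  linarith

lemma add_one_div_two_mul {N : ℕ} (hN : 1 ≤ N) :
    ((N : ℝ) + 1) / (2 * N) = 1 - cantorRatio N := by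
  have : (N : ℝ) ≠ 0 := by positivity
  rw [cantorRatio]; field_simp; ring

lemma cantorGap_zero_subset {N : ℕ} (hN : 2 ≤ N) :
    cantorGap N 0 ⊆ Set.Ioo (cantorRatio N) (1 - cantorRatio N) := by
  have hr := cantorRatio_pos hN
  rintro x ⟨⟨hx0, hx1⟩, hx⟩
  simp only [cantorStage, Set.mem_union, not_or, add_one_div_two_mul (by omega : 1 ≤ N)] at hx
  constructor
  · by_contra! hc
    exact hx.1 ⟨x / cantorRatio N, ⟨by positivity, by rwa [div_le_one hr]⟩, by field_simp⟩
  · by_contra! hc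
    refine hx.2 ⟨(x - (1 - cantorRatio N)) / cantorRatio N, ⟨?_, ?_⟩, by field_simp; ring⟩
    · exact div_nonneg (by linarith) hr.le
    · rw [div_le_one hr]; linarith

lemma exists_of_mem_cantorGap_succ {N s : ℕ} (hN : 1 ≤ N) {x : ℝ}
    (hx : x ∈ cantorGap N (s + 1)) :
    ∃ u ∈ cantorGap N s, x = cantorRatio N * u ∨ x = cantorRatio N * u + (1 - cantorRatio N) := by
  rw [← add_one_div_two_mul hN]
  obtain ⟨hx1, hx2⟩ := hx
  rw [cantorStage] at hx1 hx2
  rcases hx1 with ⟨u, hu, rfl⟩ | ⟨u, hu, rfl⟩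
  · exact ⟨u, ⟨hu, fun h => hx2 (Or.inl ⟨u, h, rfl⟩)⟩, Or.inl rfl⟩
  · exact ⟨u, ⟨hu, fun h => hx2 (Or.inr ⟨u, h, rfl⟩)⟩, Or.inr rfl⟩

lemma cantorGap_subset_Ioo {N : ℕ} (hN : 2 ≤ N) (s : ℕ) :
    cantorGap N s ⊆ Set.Ioo (cantorRatio N ^ (s + 1)) (1 - cantorRatio N ^ (s + 1)) := by
  have hr := cantorRatio_pos hN
  have hr2 := cantorRatio_lt_half (by omega : 1 ≤ N)
  induction s with
  | zero => simpa using cantorGap_zero_subset hN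
  | succ s ih =>
    intro x hx
    obtain ⟨u, hu, hxu⟩ := exists_of_mem_cantorGap_succ (by omega) hx
    obtain ⟨h1, h2⟩ := ih hu
    have h3 := mul_lt_mul_of_pos_left h1 hr
    have h4 := mul_lt_mul_of_pos_left h2 hr
    rw [pow_succ']
    rcases hxu with rfl | rfl <;> constructor <;> linarith

/-- Two points removed at step `s` lie in the same gap, or are at least two halves of a
stage-`s` interval apart. -/
lemma cantorGap_separated {N : ℕ} (hN : 2 ≤ N) (s : ℕ) {x y : ℝ} (hx : x ∈ cantorGap N s)
    (hy : y ∈ cantorGap N s) (hxy : x ≤ y) :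
    y - x < cantorRatio N ^ s / N ∨ 2 * cantorRatio N ^ (s + 1) < y - x := by
  have hr := cantorRatio_pos hN
  have hr2 := cantorRatio_lt_half (by omega : 1 ≤ N)
  induction s generalizing x y with
  | zero =>
    left
    have h1 := cantorGap_zero_subset hN hx
    have h2 := cantorGap_zero_subset hN hy
    have h3 := two_mul_cantorRatio (by omega : 1 ≤ N)
    rw [pow_zero]
    linarith [h1.1, h2.2]
  | succ s ih =>
    obtain ⟨u, hu, hxu⟩ := exists_of_mem_cantorGap_succ (by omega) hx
    obtain ⟨v, hv, hyv⟩ := exists_of_mem_cantorGap_succ (by omega) hy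
    have hscale : u ≤ v → cantorRatio N * v - cantorRatio N * u < cantorRatio N ^ (s + 1) / N ∨
        2 * cantorRatio N ^ (s + 1 + 1) < cantorRatio N * v - cantorRatio N * u := by
      intro huv
      rw [pow_succ' _ (s + 1), pow_succ' _ s, mul_div_assoc, ← mul_sub, mul_lt_mul_iff_right₀ hr,
        mul_left_comm, mul_lt_mul_iff_right₀ hr, ← pow_succ']
      exact ih hu hv huv
    obtain ⟨hu1, hu2⟩ := cantorGap_subset_Ioo hN s hu
    obtain ⟨hv1, hv2⟩ := cantorGap_subset_Ioo hN s hv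
    have hp : 0 < cantorRatio N ^ (s + 1) := by positivity
    rcases hxu with rfl | rfl <;> rcases hyv with rfl | rfl
    · exact hscale (le_of_mul_le_mul_left hxy hr)
    · right
      rw [pow_succ' _ (s + 1)]
      nlinarith
    · exfalso
      nlinarith
    · have := hscale (le_of_mul_le_mul_left (by linarith) hr)
      rwa [add_sub_add_right_eq_sub]

/-- The separation of gaps persists for the periodic extension of a translate. -/
lemma cantorGap_separated_fract {N : ℕ} (hN : 2 ≤ N) (s : ℕ) {x y : ℝ}
    (hx : Int.fract x ∈ cantorGap N s) (hy : Int.fract y ∈ cantorGap N s) (hxy : x ≤ y) :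
    y - x < cantorRatio N ^ s / N ∨ 2 * cantorRatio N ^ (s + 1) < y - x := by
  have hfx := Int.floor_add_fract x
  have hfy := Int.floor_add_fract y
  rcases (Int.floor_mono hxy).eq_or_lt with h | h
  · have hf : y - x = Int.fract y - Int.fract x := by
      rw [h] at hfx; linarith
    rw [hf]
    exact cantorGap_separated hN s hx hy (by linarith)
  · right
    have h' : (⌊x⌋ : ℝ) + 1 ≤ ⌊y⌋ := by exact_mod_cast h
    have h1 := (cantorGap_subset_Ioo hN s hx).2
    have h2 := (cantorGap_subset_Ioo hN s hy).1
    linarith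

/-- the dyadic interval with index `n` at depth `l` meets, in the periodic extension of the
translate by `b`, a gap whose length lies between one and two lengths of the dyadic interval -/
def MeetsGap (N : ℕ) (b : ℝ) (l n : ℕ) : Prop :=
  ∃ s, 1 < cantorRatio N ^ s / N * 2 ^ l ∧ cantorRatio N ^ s / N * 2 ^ l ≤ 2 ∧
    ∃ y ∈ dyadicIcc l n, Int.fract (y - b) ∈ cantorGap N s

lemma le_of_cantorRatio_scale {N : ℕ} (hN : 2 ≤ N) {s t l : ℕ}
    (hs : 1 < cantorRatio N ^ s / N * 2 ^ l) (ht : cantorRatio N ^ t / N * 2 ^ l ≤ 2) :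
    s ≤ t := by
  by_contra! h
  have hr := cantorRatio_pos hN
  have hr2 := cantorRatio_lt_half (by omega : 1 ≤ N)
  have h1 : cantorRatio N ^ s ≤ cantorRatio N ^ t * (1 / 2) := by
    calc cantorRatio N ^ s ≤ cantorRatio N ^ (t + 1) :=
          pow_le_pow_of_le_one hr.le (by linarith) h
      _ ≤ _ := by rw [pow_succ]; gcongr
  have h2 : cantorRatio N ^ s / N * 2 ^ l ≤ cantorRatio N ^ t * (1 / 2) / N * 2 ^ l := by gcongr
  have h3 : cantorRatio N ^ t * (1 / 2) / N * 2 ^ l = cantorRatio N ^ t / N * 2 ^ l / 2 := by ring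
  linarith

lemma MeetsGap.lt {N : ℕ} (hN : 2 ≤ N) {b : ℝ} {l n M : ℕ} (h : MeetsGap N b l n)
    (hM : 2 ^ M < N) : M < l := by
  obtain ⟨s, hs, -, -⟩ := h
  have hr := cantorRatio_pos hN
  have hr2 := cantorRatio_lt_half (by omega : 1 ≤ N)
  have hN0 : (0 : ℝ) < N := by positivity
  have h1 : cantorRatio N ^ s ≤ 1 := pow_le_one₀ hr.le (by linarith)
  rw [div_mul_eq_mul_div, lt_div_iff₀ hN0, one_mul] at hs
  have h2 : (N : ℝ) ≤ 2 ^ l := hs.le.trans (mul_le_of_le_one_left (by positivity) h1)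
  have h3 : N ≤ 2 ^ l := by exact_mod_cast h2
  exact (Nat.pow_lt_pow_iff_right (by norm_num)).1 (hM.trans_le h3)

lemma MeetsGap.le_add_two {N : ℕ} (hN : 2 ≤ N) {b : ℝ} {l n n' : ℕ} (h : MeetsGap N b l n)
    (h' : MeetsGap N b l n') (hn : n' + 2 ≤ n + N) : n' ≤ n + 2 := by
  rcases le_or_gt n' n with hle | hlt
  · omega
  obtain ⟨s, hs1, hs2, y, ⟨hy1, hy2⟩, hg⟩ := h
  obtain ⟨t, ht1, ht2, z, ⟨hz1, hz2⟩, hg'⟩ := h'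
  obtain rfl : s = t :=
    le_antisymm (le_of_cantorRatio_scale hN hs1 ht2) (le_of_cantorRatio_scale hN ht1 hs2)
  have hP : (0 : ℝ) < 2 ^ l := by positivity
  have hyz : y ≤ z := by
    refine hy2.trans (le_trans ?_ hz1)
    gcongr
    exact_mod_cast hlt
  rw [div_le_iff₀ hP] at hy1 hz1
  rw [le_div_iff₀ hP] at hy2 hz2
  rcases cantorGap_separated_fract hN s hg hg' (by linarith) with hd | hd
  · have h1 := mul_lt_mul_of_pos_right hd hP
    have h2 : (n' : ℝ) < n + 3 := by nlinarith
    have h3 : n' < n + 3 := by exact_mod_cast h2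
    omega
  · exfalso
    have hN1 : (1 : ℝ) ≤ N := by exact_mod_cast (by omega : 1 ≤ N)
    have h1 := mul_lt_mul_of_pos_right hd hP
    have h2 : 2 * cantorRatio N ^ (s + 1) * 2 ^ l
        = (N - 1) * (cantorRatio N ^ s / N * 2 ^ l) := by
      have hN0 : (N : ℝ) ≠ 0 := by positivity
      rw [pow_succ, show 2 * (cantorRatio N ^ s * cantorRatio N)
        = cantorRatio N ^ s * (2 * cantorRatio N) by ring, two_mul_cantorRatio (by omega)]
      field_simp
    have h3 : ((N : ℝ) - 1) * 1 ≤ (N - 1) * (cantorRatio N ^ s / N * 2 ^ l) := by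
      gcongr
    have h4 : (n' : ℝ) + 2 ≤ n + N := by exact_mod_cast hn
    nlinarith

open Classical in
/-- In a block of at most `N - 1` consecutive nodes at most three meet a gap of comparable
length. -/
lemma card_filter_meetsGap_le {N : ℕ} (hN : 2 ≤ N) (b : ℝ) {l u v : ℕ} (huv : v + 1 ≤ u + N) :
    ((Finset.Ico u v).filter (MeetsGap N b l)).card ≤ 3 := by
  set S := (Finset.Ico u v).filter (MeetsGap N b l) with hS
  rcases S.eq_empty_or_nonempty with h | h
  · simp [h]
  · have hmin := S.min'_mem h
    have hsub : S ⊆ Finset.Icc (S.min' h) (S.min' h + 2) := by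
      intro n hn
      refine Finset.mem_Icc.2 ⟨S.min'_le n hn, ?_⟩
      have h1 := Finset.mem_filter.1 hmin
      have h2 := Finset.mem_filter.1 hn
      rw [Finset.mem_Ico] at h1 h2
      exact h1.2.le_add_two hN h2.2 (by omega)
    refine (Finset.card_le_card hsub).trans ?_
    rw [Nat.card_Icc]
    omega

open Classical in
lemma card_filter_exists_meetsGap_le {N m : ℕ} (hN : 2 ≤ N) (a : Fin m → ℝ) {l u v : ℕ}
    (huv : v + 1 ≤ u + N) :
    ((Finset.Ico u v).filter (fun n => ∃ i, MeetsGap N (a i) l n)).card ≤ 3 * m := by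
  have hsub : (Finset.Ico u v).filter (fun n => ∃ i, MeetsGap N (a i) l n) ⊆
      Finset.univ.biUnion (fun i => (Finset.Ico u v).filter (MeetsGap N (a i) l)) := by
    intro n hn
    simp only [Finset.mem_filter] at hn
    obtain ⟨h1, i, h2⟩ := hn
    exact Finset.mem_biUnion.2 ⟨i, Finset.mem_univ i, Finset.mem_filter.2 ⟨h1, h2⟩⟩
  refine (Finset.card_le_card hsub).trans ((Finset.card_biUnion_le_card_mul _ _ 3
    (fun i _ => card_filter_meetsGap_le hN (a i) huv)).trans_eq ?_)
  simp [mul_comm]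

lemma exists_cantorRatio_scale {N : ℕ} (hN : 2 ≤ N) (s : ℕ) :
    ∃ l : ℕ, 1 < cantorRatio N ^ s / N * 2 ^ l ∧ cantorRatio N ^ s / N * 2 ^ l ≤ 2 := by
  have hr := cantorRatio_pos hN
  have hr2 := cantorRatio_lt_half (by omega : 1 ≤ N)
  have hN1 : (1 : ℝ) ≤ N := by exact_mod_cast (by omega : 1 ≤ N)
  have hg : 0 < cantorRatio N ^ s / N := by positivity
  have hg1 : cantorRatio N ^ s / N ≤ 1 := by
    rw [div_le_one (by linarith)]
    exact (pow_le_one₀ hr.le (by linarith)).trans hN1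
  obtain ⟨l, h1, h2⟩ := exists_nat_pow_near_of_lt_one hg hg1 (y := (1 / 2 : ℝ))
    (by norm_num) (by norm_num)
  refine ⟨l + 1, ?_, ?_⟩
  · rwa [div_pow, one_pow, div_lt_iff₀ (by positivity)] at h1
  · rw [div_pow, one_pow, le_div_iff₀ (by positivity)] at h2
    rw [pow_succ]
    linarith

lemma mem_transl_middleCantorSet {N : ℕ} {b y : ℝ}
    (h : ∀ s, Int.fract (y - b) ∉ cantorGap N s) :
    (y : AddCircle (1 : ℝ)) ∈ transl b (middleCantorSet N) := by
  refine ⟨Int.fract (y - b), Set.mem_iInter.2 (mem_cantorStage_of_notMem_cantorGap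
    ⟨Int.fract_nonneg _, (Int.fract_lt_one _).le⟩ h), ?_⟩
  have hf : Int.fract (y - b) + b + ⌊y - b⌋ • (1 : ℝ) = y := by
    have := Int.floor_add_fract (y - b)
    rw [zsmul_one]
    linarith
  conv_rhs => rw [← hf]
  simp

theorem nonempty_iInter_transl {N m j : ℕ} (hj : 2 ^ (j + 1) < N)
    (hm : 4 * (j + 1) * (3 * m) ≤ 2 ^ (j + 1)) (a : Fin m → ℝ) :
    (⋂ i, transl (a i) (middleCantorSet N)).Nonempty := by
  classical
  have hN : 2 ≤ N := by have := Nat.one_le_two_pow (n := j + 1); omega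
  obtain ⟨y, hy⟩ := exists_mem_dyadicIcc_survivors
    (survivors_nonempty (bad := fun l n => ∃ i, MeetsGap N (a i) l n) (j := j) (D := 3 * m)
      (fun l hl n ⟨i, hi⟩ => by have := hi.lt hN hj; omega)
      (fun l p => by
        convert card_filter_exists_meetsGap_le hN a (l := l) (u := p * 2 ^ (j + 1))
          (v := (p + 1) * 2 ^ (j + 1)) (by rw [add_mul]; omega)) hm)
  refine ⟨y, Set.mem_iInter.2 fun i => mem_transl_middleCantorSet fun s hs => ?_⟩
  obtain ⟨l, h1, h2⟩ := exists_cantorRatio_scale hN s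
  obtain ⟨n, hn, hyn⟩ := hy l
  have hmeets : MeetsGap N (a i) l n := ⟨s, h1, h2, y, hyn, hs⟩
  have hl := hmeets.lt hN hj
  cases l with
  | zero => omega
  | succ l => exact (mem_survivors_succ.1 hn).2.2 ⟨i, hmeets⟩

theorem stmt6 : ∃ N₀ : ℕ, ∀ N : ℕ, N₀ ≤ N →
    ∀ a : Fin ⌊(N : ℝ) / (100 * Real.logb 2 N)⌋₊ → ℝ,
      (⋂ i, transl (a i) (middleCantorSet N)).Nonempty := by
  refine ⟨4, fun N hN a => ?_⟩
  have hlog : 1 ≤ Nat.log 2 (N - 1) := Nat.log_pos (by norm_num) (by omega)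
  obtain ⟨j, hj⟩ := Nat.exists_eq_add_of_le' hlog
  have hlow : 2 ^ (j + 1) ≤ N - 1 := hj ▸ Nat.pow_log_le_self 2 (by omega)
  have hupp : N - 1 < 2 ^ (j + 1 + 1) := hj ▸ Nat.lt_pow_succ_log_self (by norm_num) _
  refine nonempty_iInter_transl (j := j) (by omega) ?_ a
  have hN0 : (0 : ℝ) < N := by positivity
  have hjN : ((j : ℝ) + 1) ≤ Real.logb 2 N := by
    rw [Real.le_logb_iff_rpow_le (by norm_num) hN0]
    have : 2 ^ (j + 1) ≤ N := by omega
    exact_mod_cast this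
  have hL : 0 < Real.logb 2 N := lt_of_lt_of_le (by positivity) hjN
  have hm := Nat.floor_le (show 0 ≤ (N : ℝ) / (100 * Real.logb 2 N) by positivity)
  set m := ⌊(N : ℝ) / (100 * Real.logb 2 N)⌋₊
  rw [le_div_iff₀ (by positivity)] at hm
  have h1 : (m : ℝ) * (j + 1) ≤ m * Real.logb 2 N := by gcongr
  have h2 : (N : ℝ) ≤ 2 * 2 ^ (j + 1) := by
    rw [pow_succ] at hupp
    exact_mod_cast (by omega : N ≤ 2 * 2 ^ (j + 1))
  have h3 : (0 : ℝ) < 2 ^ (j + 1) := by positivity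
  have h4 : (4 : ℝ) * (j + 1) * (3 * m) ≤ 2 ^ (j + 1) := by linarith
  exact_mod_cast h4
end

section
/- For N sufficiently large, the middle 1/N-th Cantor set X contains an arithmetic progression of length ⌊N/(100 log₂ N)⌋, i.e., there exist x and d > 0 with x, x+d, …, x+(m-1)d ∈ X where m = ⌊N/(100 log₂ N)⌋. -/
open Set

/-- The centres of the open intervals removed at stage `k` of the construction. -/
noncomputable def gapCenters (N : ℕ) : ℕ → Finset ℝ
  | 0 => {1 / 2}
  | k + 1 => (gapCenters N k).image (fun c => cantorRatio N * c) ∪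
      (gapCenters N k).image (fun c => cantorRatio N * c + (N + 1) / (2 * N))

/-- The length of the open intervals removed at stage `k` of the construction. -/
noncomputable def gapLength (N k : ℕ) : ℝ := cantorRatio N ^ k / N

/-- The projection of `x` to the interval of radius `ρ` around `c`. -/
noncomputable def clampAround (ρ c x : ℝ) : ℝ := max (c - ρ) (min (c + ρ) x)

/-- The increment of this function on an interval `J` is the total overlap of the translates
`J + i * d`, `i < m`, with the stage-`k` gaps tripled in length. -/
noncomputable def gapOverlap (N m : ℕ) (d : ℝ) (k : ℕ) (x : ℝ) : ℝ :=
  ∑ i ∈ Finset.range m, ∑ c ∈ gapCenters N k, clampAround (3 / 2 * gapLength N k) c (x + i * d)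

lemma cantorRatio_le_half {N : ℕ} (hN : 2 ≤ N) : cantorRatio N ≤ 1 / 2 := by
  have h : (2 : ℝ) ≤ N := by exact_mod_cast hN
  unfold cantorRatio
  rw [div_le_div_iff₀ (by linarith) (by norm_num)]
  linarith

lemma cantorRatio_eq {N : ℕ} (hN : 2 ≤ N) : cantorRatio N = 1 / 2 - 1 / N / 2 := by
  have h : (2 : ℝ) ≤ N := by exact_mod_cast hN
  unfold cantorRatio
  field_simp

lemma translation_eq {N : ℕ} (hN : 2 ≤ N) :
    ((N : ℝ) + 1) / (2 * N) = 1 - cantorRatio N := by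
  have h : (2 : ℝ) ≤ N := by exact_mod_cast hN
  unfold cantorRatio
  field_simp
  ring

lemma gapLength_succ (N k : ℕ) : gapLength N (k + 1) = cantorRatio N * gapLength N k := by
  unfold gapLength
  ring

lemma gapLength_pos {N : ℕ} (hN : 2 ≤ N) (k : ℕ) : 0 < gapLength N k := by
  have h : (2 : ℝ) ≤ N := by exact_mod_cast hN
  have := cantorRatio_pos hN
  unfold gapLength
  positivity

lemma gapCenters_mem_Icc {N : ℕ} (hN : 2 ≤ N) (k : ℕ) : ∀ c ∈ gapCenters N k,
    cantorRatio N ^ k / 2 ≤ c ∧ c ≤ 1 - cantorRatio N ^ k / 2 := by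
  have hr := cantorRatio_pos hN
  have hr2 := cantorRatio_le_half hN
  induction k with
  | zero => simp [gapCenters]; norm_num
  | succ k ih =>
    intro c hc
    simp only [gapCenters, Finset.mem_union, Finset.mem_image, translation_eq hN] at hc
    rw [pow_succ]
    rcases hc with ⟨b, hb, rfl⟩ | ⟨b, hb, rfl⟩ <;> obtain ⟨h1, h2⟩ := ih b hb <;>
      constructor <;> nlinarith

lemma gapCenters_separated {N : ℕ} (hN : 2 ≤ N) (k : ℕ) : ∀ b ∈ gapCenters N k,
    ∀ c ∈ gapCenters N k, b < c → cantorRatio N ^ k ≤ c - b := by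
  have hr := cantorRatio_pos hN
  have hr2 := cantorRatio_le_half hN
  induction k with
  | zero =>
    intro b hb c hc h
    simp only [gapCenters, Finset.mem_singleton] at hb hc
    linarith
  | succ k ih =>
    intro b hb c hc h
    simp only [gapCenters, Finset.mem_union, Finset.mem_image, translation_eq hN] at hb hc
    rw [pow_succ]
    rcases hb with ⟨b, hb, rfl⟩ | ⟨b, hb, rfl⟩ <;> rcases hc with ⟨c, hc, rfl⟩ | ⟨c, hc, rfl⟩
    · have := ih b hb c hc (by nlinarith)
      nlinarith
    · have := gapCenters_mem_Icc hN k b hb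
      have := gapCenters_mem_Icc hN k c hc
      nlinarith
    · have := gapCenters_mem_Icc hN k b hb
      have := gapCenters_mem_Icc hN k c hc
      have : 0 < cantorRatio N ^ k := by positivity
      nlinarith
    · have := ih b hb c hc (by nlinarith)
      nlinarith

lemma mem_cantorStage_of_gaps {N : ℕ} (hN : 2 ≤ N) (n : ℕ) : ∀ x ∈ Icc (0 : ℝ) 1,
    (∀ k < n, ∀ c ∈ gapCenters N k, gapLength N k / 2 ≤ |x - c|) → x ∈ cantorStage N n := by
  have hr := cantorRatio_pos hN
  have hrN := cantorRatio_eq hN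
  induction n with
  | zero => intro x hx _; exact hx
  | succ n ih =>
    intro x hx h
    have h0 := h 0 (by omega) (1 / 2) (by simp [gapCenters])
    simp only [gapLength, pow_zero] at h0
    rw [cantorStage]
    rcases le_abs.1 h0 with h0 | h0
    · right
      refine ⟨(x - (1 - cantorRatio N)) / cantorRatio N, ih _ ⟨?_, ?_⟩ ?_, ?_⟩
      · apply div_nonneg <;> linarith
      · rw [div_le_one hr]; linarith [hx.2]
      · intro k hk c hc
        have := h (k + 1) (by omega) (cantorRatio N * c + (N + 1) / (2 * N)) (by
          simp only [gapCenters, Finset.mem_union, Finset.mem_image]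
          exact Or.inr ⟨c, hc, rfl⟩)
        rw [gapLength_succ, translation_eq hN,
          show x - (cantorRatio N * c + (1 - cantorRatio N)) = cantorRatio N *
            ((x - (1 - cantorRatio N)) / cantorRatio N - c) by field_simp; ring,
          abs_mul, abs_of_pos hr, mul_div_assoc] at this
        exact le_of_mul_le_mul_left this hr
      · simp only [translation_eq hN]
        field_simp
        ring
    · left
      refine ⟨x / cantorRatio N, ih _ ⟨?_, ?_⟩ ?_, ?_⟩
      · exact div_nonneg hx.1 hr.le
      · rw [div_le_one hr]; linarith
      · intro k hk c hc
        have := h (k + 1) (by omega) (cantorRatio N * c) (by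
          simp only [gapCenters, Finset.mem_union, Finset.mem_image]
          exact Or.inl ⟨c, hc, rfl⟩)
        rw [gapLength_succ,
          show x - cantorRatio N * c = cantorRatio N * (x / cantorRatio N - c) by field_simp,
          abs_mul, abs_of_pos hr, mul_div_assoc] at this
        exact le_of_mul_le_mul_left this hr
      · simp only
        field_simp

lemma card_le_of_separated {S : Finset ℝ} {s a L : ℝ} (hs : 0 < s) (hL : 0 ≤ L)
    (hsep : ∀ b ∈ S, ∀ c ∈ S, b < c → s ≤ c - b) (hS : ∀ c ∈ S, a ≤ c ∧ c ≤ a + L) :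
    (S.card : ℝ) ≤ L / s + 1 := by
  have hcard : S.card ≤ (Finset.range (⌊L / s⌋₊ + 1)).card := by
    refine Finset.card_le_card_of_injOn (fun c => ⌊(c - a) / s⌋₊) ?_ ?_
    · intro c hc
      simp only [Finset.coe_range, mem_Iio, Nat.lt_succ_iff]
      exact Nat.floor_le_floor (div_le_div_of_nonneg_right (by linarith [(hS c hc).2]) hs.le)
    · have key : ∀ b ∈ S, ∀ c ∈ S, b < c → ⌊(b - a) / s⌋₊ ≠ ⌊(c - a) / s⌋₊ := by
        intro b hb c hc hbc h
        have h1 : (b - a) / s + 1 ≤ (c - a) / s := by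
          rw [div_add_one hs.ne']
          exact div_le_div_of_nonneg_right (by linarith [hsep b hb c hc hbc]) hs.le
        have h2 := Nat.floor_le_floor h1
        rw [Nat.floor_add_one (div_nonneg (by linarith [(hS b hb).1]) hs.le)] at h2
        omega
      intro b hb c hc h
      by_contra hne
      rcases lt_or_gt_of_ne hne with hlt | hlt
      · exact key b hb c hc hlt h
      · exact key c hc b hb hlt h.symm
  rw [Finset.card_range] at hcard
  calc (S.card : ℝ) ≤ ((⌊L / s⌋₊ + 1 : ℕ) : ℝ) := by exact_mod_cast hcard
    _ ≤ L / s + 1 := by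
      push_cast
      linarith [Nat.floor_le (div_nonneg hL hs.le)]

lemma clampAround_monotone (ρ c : ℝ) : Monotone (clampAround ρ c) := fun _ _ h =>
  max_le_max le_rfl (min_le_min le_rfl h)

lemma clampAround_sub_le {ρ : ℝ} (hρ : 0 ≤ ρ) (c x y : ℝ) :
    clampAround ρ c y - clampAround ρ c x ≤ 2 * ρ := by
  have h1 : clampAround ρ c y ≤ c + ρ := max_le (by linarith) (min_le_left _ _)
  have h2 : c - ρ ≤ clampAround ρ c x := le_max_left _ _
  linarith

lemma clampAround_of_mem {ρ c x : ℝ} (h1 : c - ρ ≤ x) (h2 : x ≤ c + ρ) :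
    clampAround ρ c x = x := by
  rw [clampAround, min_eq_right h2, max_eq_right h1]

lemma sum_clampAround_sub_le {S : Finset ℝ} {s ρ x y : ℝ} (hs : 0 < s) (hρ : 0 ≤ ρ) (hxy : x ≤ y)
    (hsep : ∀ b ∈ S, ∀ c ∈ S, b < c → s ≤ c - b) :
    ∑ c ∈ S, (clampAround ρ c y - clampAround ρ c x) ≤ ((y - x + 2 * ρ) / s + 1) * (2 * ρ) := by
  classical
  set T := S.filter (fun c => x - ρ ≤ c ∧ c ≤ x - ρ + (y - x + 2 * ρ)) with hT
  have hzero : ∀ c ∈ S, c ∉ T → clampAround ρ c y - clampAround ρ c x = 0 := by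
    intro c hc hcT
    simp only [hT, Finset.mem_filter, hc, true_and, not_and_or, not_le] at hcT
    rcases hcT with h | h
    · simp only [clampAround]
      rw [min_eq_left (by linarith), min_eq_left (by linarith), sub_self]
    · simp only [clampAround]
      rw [min_eq_right (by linarith), min_eq_right (by linarith), max_eq_left (by linarith),
        max_eq_left (by linarith), sub_self]
  rw [← Finset.sum_subset (Finset.filter_subset _ S) hzero]
  calc ∑ c ∈ T, (clampAround ρ c y - clampAround ρ c x) ≤ T.card • (2 * ρ) :=
        Finset.sum_le_card_nsmul _ _ _ fun c _ => clampAround_sub_le hρ c x y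
    _ = T.card * (2 * ρ) := nsmul_eq_mul _ _
    _ ≤ ((y - x + 2 * ρ) / s + 1) * (2 * ρ) := by
      gcongr
      refine card_le_of_separated (a := x - ρ) hs (by linarith) ?_ ?_
      · intro b hb c hc
        exact hsep b (Finset.mem_of_mem_filter b hb) c (Finset.mem_of_mem_filter c hc)
      · intro c hc
        exact (Finset.mem_filter.1 hc).2

lemma gapOverlap_monotone (N m : ℕ) (d : ℝ) (k : ℕ) : Monotone (gapOverlap N m d k) :=
  fun _ _ h => Finset.sum_le_sum fun _ _ => Finset.sum_le_sum fun _ _ =>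
    clampAround_monotone _ _ (by linarith)

lemma gapOverlap_sub_le {N : ℕ} (hN : 18 ≤ N) (m : ℕ) (d : ℝ) {k : ℕ} {x ℓ : ℝ}
    (hk : cantorRatio N ^ k ≤ 2 * ℓ) :
    gapOverlap N m d k (x + ℓ) - gapOverlap N m d k x ≤ 10 * m / N * ℓ := by
  have hN' : (18 : ℝ) ≤ N := by exact_mod_cast hN
  have hr := cantorRatio_pos (N := N) (by omega)
  have hg := gapLength_pos (N := N) (by omega) k
  have hrk : 0 < cantorRatio N ^ k := by positivity
  have hgr : gapLength N k * 18 ≤ cantorRatio N ^ k := by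
    rw [gapLength, div_mul_eq_mul_div, div_le_iff₀ (by linarith)]
    gcongr
  simp only [gapOverlap, ← Finset.sum_sub_distrib]
  have hterm : ∀ i ∈ Finset.range m, ∑ c ∈ gapCenters N k,
      (clampAround (3 / 2 * gapLength N k) c (x + ℓ + i * d) -
        clampAround (3 / 2 * gapLength N k) c (x + i * d)) ≤ 10 / N * ℓ := by
    intro i _
    refine (sum_clampAround_sub_le hrk (by positivity) (by linarith)
      (gapCenters_separated (by omega) k)).trans ?_
    have : ((x + ℓ + i * d - (x + i * d) + 2 * (3 / 2 * gapLength N k)) / cantorRatio N ^ k + 1)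
        * (2 * (3 / 2 * gapLength N k)) =
        (3 * ℓ + 9 * gapLength N k + 3 * cantorRatio N ^ k) / N := by
      rw [show 2 * (3 / 2 * gapLength N k) = 3 * gapLength N k by ring]
      nth_rewrite 2 [gapLength]
      field_simp
      ring
    rw [this, div_mul_eq_mul_div]
    gcongr
    linarith
  refine (Finset.sum_le_card_nsmul _ _ _ hterm).trans (le_of_eq ?_)
  rw [Finset.card_range, nsmul_eq_mul]
  ring

lemma gap_le_abs_sub_of_gapOverlap {N m k : ℕ} {d x ℓ : ℝ} (hℓ : 0 ≤ ℓ)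
    (hg : ℓ ≤ gapLength N k) (h : gapOverlap N m d k (x + ℓ) - gapOverlap N m d k x < ℓ)
    {y : ℝ} (hy : y ∈ Icc x (x + ℓ)) {i : ℕ} (hi : i < m) {c : ℝ} (hc : c ∈ gapCenters N k) :
    gapLength N k / 2 ≤ |y + i * d - c| := by
  by_contra! hlt
  obtain ⟨h1, h2⟩ := abs_lt.1 hlt
  obtain ⟨hy1, hy2⟩ := hy
  have hnn : ∀ (j : ℕ) (b : ℝ), 0 ≤ clampAround (3 / 2 * gapLength N k) b (x + ℓ + j * d) -
      clampAround (3 / 2 * gapLength N k) b (x + j * d) := fun j b =>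
    sub_nonneg.2 (clampAround_monotone _ _ (by linarith))
  simp only [gapOverlap, ← Finset.sum_sub_distrib] at h
  have e1 := Finset.single_le_sum (f := fun j : ℕ => ∑ c ∈ gapCenters N k,
    (clampAround (3 / 2 * gapLength N k) c (x + ℓ + j * d) -
      clampAround (3 / 2 * gapLength N k) c (x + j * d)))
    (fun j _ => Finset.sum_nonneg fun b _ => hnn j b) (Finset.mem_range.2 hi)
  have e2 := Finset.single_le_sum (f := fun c =>
    (clampAround (3 / 2 * gapLength N k) c (x + ℓ + i * d) -
      clampAround (3 / 2 * gapLength N k) c (x + i * d)))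
    (fun b _ => hnn i b) hc
  rw [clampAround_of_mem (by linarith) (by linarith),
    clampAround_of_mem (by linarith) (by linarith)] at e2
  linarith

lemma exists_increment_lt {H : ℝ → ℝ} {M : ℕ} {a ℓ : ℝ}
    (h : H (a + M * ℓ) - H a < M * ℓ) :
    ∃ j < M, H (a + j * ℓ + ℓ) - H (a + j * ℓ) < ℓ := by
  have hsum := Finset.sum_range_sub (fun j : ℕ => H (a + j * ℓ)) M
  simp only [Nat.cast_zero, zero_mul, add_zero] at hsum
  rw [← hsum] at h
  obtain ⟨j, hj, hlt⟩ := Finset.exists_lt_of_sum_lt (s := Finset.range M) (g := fun _ => ℓ)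
    (h.trans_eq (by simp))
  refine ⟨j, Finset.mem_range.1 hj, ?_⟩
  push_cast at hlt
  rwa [add_mul, one_mul, ← add_assoc] at hlt

/-- An interval of length `r ^ n / 2` is good at level `n` if its translates avoid the gaps of all
stages below `n - q`, and overlap little with the gaps of the next `q` stages. -/
def IsGoodStart (N m q : ℕ) (d : ℝ) (n : ℕ) (a : ℝ) : Prop :=
  0 ≤ a ∧ a + cantorRatio N ^ n / 2 ≤ 1 / 2 ∧
  (∀ k < n - q, ∀ y ∈ Icc a (a + cantorRatio N ^ n / 2), ∀ i < m, ∀ c ∈ gapCenters N k,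
    gapLength N k / 2 ≤ |y + i * d - c|) ∧
  ∑ k ∈ Finset.Ico (n - q) n,
    (gapOverlap N m d k (a + cantorRatio N ^ n / 2) - gapOverlap N m d k a) ≤
      cantorRatio N ^ n / 2 / 2

lemma IsGoodStart.exists_next {N m q : ℕ} {d : ℝ} (hN : 18 ≤ N) (hq : N ≤ 2 ^ q)
    (hm : (80 : ℝ) * q * m ≤ N) {n : ℕ} {a : ℝ} (ha : IsGoodStart N m q d n a) :
    ∃ b, IsGoodStart N m q d (n + q) b := by
  obtain ⟨ha0, ha1, hav, hpot⟩ := ha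
  have hN' : (18 : ℝ) ≤ N := by exact_mod_cast hN
  have hr := cantorRatio_pos (N := N) (by omega)
  have hr2 := cantorRatio_le_half (N := N) (by omega)
  set ℓ := cantorRatio N ^ n / 2 with hℓ
  set ℓ' := cantorRatio N ^ (n + q) / 2 with hℓ'
  have hℓ0 : 0 < ℓ := by positivity
  have hℓ'0 : 0 < ℓ' := by positivity
  have hrq : cantorRatio N ^ q ≤ 1 / N := by
    calc cantorRatio N ^ q ≤ (1 / 2) ^ q := by gcongr
      _ = 1 / 2 ^ q := by rw [one_div_pow]
      _ ≤ 1 / N := by gcongr; exact_mod_cast hq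
  have hsmall : ℓ' ≤ ℓ * (1 / N) := by
    rw [hℓ', hℓ, pow_add, mul_div_right_comm]
    gcongr
  have hsmall' : ℓ' ≤ ℓ / 18 := by
    refine hsmall.trans ?_
    rw [div_eq_mul_one_div ℓ]
    gcongr
  set M := ⌊ℓ / ℓ'⌋₊ with hM
  have hM1 : M * ℓ' ≤ ℓ := (le_div_iff₀ hℓ'0).1 (Nat.floor_le (by positivity))
  have hM2 : ℓ < (M + 1) * ℓ' := (div_lt_iff₀ hℓ'0).1 (Nat.lt_floor_add_one _)
  have hnew : ∑ k ∈ Finset.Ico n (n + q),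
      (gapOverlap N m d k (a + ℓ) - gapOverlap N m d k a) ≤ ℓ / 8 := by
    have hterm : ∀ k ∈ Finset.Ico n (n + q),
        gapOverlap N m d k (a + ℓ) - gapOverlap N m d k a ≤ 10 * m / N * ℓ := by
      intro k hk
      refine gapOverlap_sub_le hN m d ?_
      rw [hℓ, mul_div_cancel₀ _ two_ne_zero]
      exact pow_le_pow_of_le_one hr.le (by linarith) (Finset.mem_Ico.1 hk).1
    refine (Finset.sum_le_card_nsmul _ _ _ hterm).trans ?_
    rw [Nat.card_Ico, nsmul_eq_mul, add_tsub_cancel_left,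
      show (q : ℝ) * (10 * m / N * ℓ) = (80 * q * m) / N * (ℓ / 8) by ring]
    exact mul_le_of_le_one_left (by positivity) (div_le_one_of_le₀ hm (by positivity))
  set H : ℝ → ℝ := fun x => ∑ k ∈ Finset.Ico (n - q) n, gapOverlap N m d k x +
    2 * ∑ k ∈ Finset.Ico n (n + q), gapOverlap N m d k x with hH
  have hsub : ∀ x y, H y - H x =
      ∑ k ∈ Finset.Ico (n - q) n, (gapOverlap N m d k y - gapOverlap N m d k x) +
      2 * ∑ k ∈ Finset.Ico n (n + q), (gapOverlap N m d k y - gapOverlap N m d k x) := by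
    intro x y
    simp only [hH, Finset.sum_sub_distrib]
    ring
  have hmono : H (a + M * ℓ') ≤ H (a + ℓ) := by
    have h : a + M * ℓ' ≤ a + ℓ := by linarith
    simp only [hH]
    gcongr with k _ k _ <;> exact gapOverlap_monotone _ _ _ _ h
  obtain ⟨j, hj, hlt⟩ := exists_increment_lt (H := H) (M := M) (a := a) (ℓ := ℓ') (by
    have := hsub a (a + ℓ)
    linarith)
  set b := a + j * ℓ' with hb
  have hjM : ((j : ℝ) + 1) * ℓ' ≤ M * ℓ' := by
    gcongr
    exact_mod_cast hj
  have hab : a ≤ b := by rw [hb]; nlinarith [Nat.cast_nonneg (α := ℝ) j]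
  have hbb : b + ℓ' ≤ a + ℓ := by linarith
  have hnn : ∀ k, 0 ≤ gapOverlap N m d k (b + ℓ') - gapOverlap N m d k b := fun k =>
    sub_nonneg.2 (gapOverlap_monotone _ _ _ _ (by linarith))
  rw [hsub] at hlt
  have hold0 := Finset.sum_nonneg (s := Finset.Ico (n - q) n) fun k _ => hnn k
  have hnew0 := Finset.sum_nonneg (s := Finset.Ico n (n + q)) fun k _ => hnn k
  refine ⟨b, by linarith, by linarith, ?_, ?_⟩
  · rw [add_tsub_cancel_right]
    intro k hk y hy i hi c hc
    by_cases hkq : k < n - q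
    · exact hav k hkq y ⟨by linarith [hy.1], by linarith [hy.2]⟩ i hi c hc
    · refine gap_le_abs_sub_of_gapOverlap hℓ'0.le ?_ ?_ hy hi hc
      · have : cantorRatio N ^ n ≤ cantorRatio N ^ k :=
          pow_le_pow_of_le_one hr.le (by linarith) hk.le
        rw [gapLength, div_eq_mul_one_div]
        refine hsmall.trans ?_
        gcongr
        linarith
      · have := Finset.single_le_sum (s := Finset.Ico (n - q) n) (fun k _ => hnn k)
          (Finset.mem_Ico.2 ⟨not_lt.1 hkq, hk⟩)
        linarith
  · rw [add_tsub_cancel_right]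
    linarith

lemma exists_isGoodStart {N m q : ℕ} (d : ℝ) (hN : 18 ≤ N) (hq : N ≤ 2 ^ q)
    (hm : (80 : ℝ) * q * m ≤ N) (t : ℕ) : ∃ a, IsGoodStart N m q d (t * q) a := by
  induction t with
  | zero => exact ⟨0, by norm_num [IsGoodStart]⟩
  | succ t ih =>
    obtain ⟨a, ha⟩ := ih
    rw [Nat.succ_mul]
    exact ha.exists_next hN hq hm

lemma exists_avoiding_gaps {N m q : ℕ} (d : ℝ) (hN : 18 ≤ N) (hq : N ≤ 2 ^ q)
    (hm : (80 : ℝ) * q * m ≤ N) : ∃ x ∈ Icc (0 : ℝ) (1 / 2),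
      ∀ k, ∀ i < m, ∀ c ∈ gapCenters N k, gapLength N k / 2 ≤ |x + i * d - c| := by
  have hr := cantorRatio_pos (N := N) (by omega)
  have hq0 : 1 ≤ q := by
    by_contra! h
    obtain rfl : q = 0 := by omega
    simp at hq
    omega
  let K : ℕ → Set ℝ := fun n => Icc 0 (1 / 2) ∩
    {x | ∀ k < n, ∀ i < m, ∀ c ∈ gapCenters N k, gapLength N k / 2 ≤ |x + i * d - c|}
  have hclosed : ∀ n, IsClosed (K n) := by
    intro n
    refine isClosed_Icc.inter ?_
    simp only [ofPred_forall]
    refine isClosed_iInter fun k => isClosed_iInter fun _ => isClosed_iInter fun i =>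
      isClosed_iInter fun _ => isClosed_iInter fun c => isClosed_iInter fun _ =>
      isClosed_le (by fun_prop) (by fun_prop)
  have hne : ∀ n, (K n).Nonempty := by
    intro n
    obtain ⟨a, ha0, ha1, hav, -⟩ := exists_isGoodStart d hN hq hm (n + 1)
    have hpos : 0 < cantorRatio N ^ ((n + 1) * q) := by positivity
    refine ⟨a, ⟨ha0, by linarith⟩, fun k hk => hav k ?_ a ⟨le_rfl, by linarith⟩⟩
    rw [Nat.succ_mul, add_tsub_cancel_right]
    exact hk.trans_le (Nat.le_mul_of_pos_right n hq0)
  obtain ⟨x, hx⟩ := IsCompact.nonempty_iInter_of_sequence_nonempty_isCompact_isClosed K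
    (fun n x hx => ⟨hx.1, fun k hk => hx.2 k (by omega)⟩) hne
    (isCompact_Icc.inter_right (by simp)) hclosed
  rw [mem_iInter] at hx
  exact ⟨x, (hx 0).1, fun k => (hx (k + 1)).2 k (by omega)⟩

theorem stmt7 : ∃ N₀ : ℕ, ∀ N : ℕ, N₀ ≤ N →
    ∃ x d : ℝ, 0 < d ∧ ∀ i : ℕ, i < ⌊(N : ℝ) / (100 * Real.logb 2 N)⌋₊ →
      x + i * d ∈ middleCantorSet N := by
  refine ⟨18, fun N hN => ?_⟩
  have hN' : (18 : ℝ) ≤ N := by exact_mod_cast hN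
  set L := Real.logb 2 N with hL
  set m := ⌊(N : ℝ) / (100 * L)⌋₊ with hm
  have hL4 : 4 ≤ L := by
    rw [hL, Real.le_logb_iff_rpow_le (by norm_num) (by linarith)]
    norm_num
    linarith
  have hmL : m * (100 * L) ≤ N := by
    rw [← le_div_iff₀ (by linarith)]
    exact Nat.floor_le (by positivity)
  have hqL : ((Nat.log 2 N + 1 : ℕ) : ℝ) ≤ L + 1 := by
    push_cast
    gcongr
    exact_mod_cast Real.natLog_le_logb N 2
  have hbound : (80 : ℝ) * (Nat.log 2 N + 1 : ℕ) * m ≤ N := by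
    refine le_trans ?_ hmL
    rw [mul_comm (m : ℝ)]
    exact mul_le_mul_of_nonneg_right (by linarith) (Nat.cast_nonneg m)
  have hd : (0 : ℝ) < 1 / (2 * (m + 1)) := by positivity
  obtain ⟨x, hx, hgap⟩ := exists_avoiding_gaps (1 / (2 * ((m : ℝ) + 1))) hN
    (Nat.lt_pow_succ_log_self one_lt_two N).le hbound
  refine ⟨x, _, hd, fun i hi => mem_iInter.2 fun n => ?_⟩
  refine mem_cantorStage_of_gaps (by omega) n _ ⟨?_, ?_⟩ fun k _ => hgap k i hi
  · have := hx.1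
    positivity
  · have hi' : (i : ℝ) ≤ m + 1 := by
      have : (i : ℝ) ≤ m := by exact_mod_cast hi.le
      linarith
    have : (i : ℝ) * (1 / (2 * (m + 1))) ≤ 1 / 2 := by
      rw [mul_one_div, div_le_div_iff₀ (by positivity) (by norm_num)]
      linarith
    linarith [hx.2]
end
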